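/- Let P and Q be a pair of orthogonal partial latin squares of order n ≥ 1 on the set of symbols [n]. Then for every integer t ≥ 48n^4, P and Q can be embedded in a pair of orthogonal latin squares of order t. -/

import Mathlib

/-- `P` is a partial latin square of order `n`: a set of (row, column, symbol) triples
from `[n] × [n] × [n]` such that any two triples agreeing in two coordinates agree in
the third. -/
def IsPLS (n : ℕ) (P : Set (ℕ × ℕ × ℕ)) : Prop :=
  (∀ t ∈ P, t.1 < n ∧ t.2.1 < n ∧ t.2.2 < n) ∧
  (∀ r c e e', (r, c, e) ∈ P → (r, c, e') ∈ P → e = e') ∧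
  (∀ r c c' e, (r, c, e) ∈ P → (r, c', e) ∈ P → c = c') ∧
  (∀ r r' c e, (r, c, e) ∈ P → (r', c, e) ∈ P → r = r')

/-- `P` and `Q` are orthogonal partial latin squares: they have exactly the same
non-empty cells, and whenever two distinct cells of `P` carry the same symbol the
corresponding cells of `Q` carry distinct symbols. -/
def OrthPLS (P Q : Set (ℕ × ℕ × ℕ)) : Prop :=
  (∀ r c, (∃ e, (r, c, e) ∈ P) ↔ (∃ e, (r, c, e) ∈ Q)) ∧
  (∀ r₁ c₁ r₂ c₂ x y₁ y₂, ((r₁, c₁) : ℕ × ℕ) ≠ (r₂, c₂) →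
    (r₁, c₁, x) ∈ P → (r₂, c₂, x) ∈ P →
    (r₁, c₁, y₁) ∈ Q → (r₂, c₂, y₂) ∈ Q → y₁ ≠ y₂)

/-- `L` is (the table of) a latin square of order `N` on rows, columns and symbols
`[N]`. -/
def IsLatin (N : ℕ) (L : ℕ → ℕ → ℕ) : Prop :=
  (∀ r c, r < N → c < N → L r c < N) ∧
  (∀ r c₁ c₂, r < N → c₁ < N → c₂ < N → L r c₁ = L r c₂ → c₁ = c₂) ∧
  (∀ r₁ r₂ c, r₁ < N → r₂ < N → c < N → L r₁ c = L r₂ c → r₁ = r₂)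

/-- `L₁` and `L₂` are orthogonal latin squares of order `N`. -/
def OrthLatin (N : ℕ) (L₁ L₂ : ℕ → ℕ → ℕ) : Prop :=
  ∀ r₁ c₁ r₂ c₂, r₁ < N → c₁ < N → r₂ < N → c₂ < N →
    ((r₁, c₁) : ℕ × ℕ) ≠ (r₂, c₂) → L₁ r₁ c₁ = L₁ r₂ c₂ → L₂ r₁ c₁ ≠ L₂ r₂ c₂

/-- The pair `(P, Q)` of partial latin squares of order `n` embeds in a pair of
orthogonal latin squares of order `N`: there are orthogonal latin squares `L₁, L₂` of
order `N` and a common injective relabeling `f` of rows and `g` of columns, and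
injective relabelings `h₁, h₂` of symbols, mapping `P` into `L₁` and `Q` into `L₂`. -/
def EmbedsInOrthogonalPair (n N : ℕ) (P Q : Set (ℕ × ℕ × ℕ)) : Prop :=
  ∃ L₁ L₂ : ℕ → ℕ → ℕ, ∃ f g h₁ h₂ : ℕ → ℕ,
    IsLatin N L₁ ∧ IsLatin N L₂ ∧ OrthLatin N L₁ L₂ ∧
    (∀ x, x < n → f x < N) ∧ (∀ x, x < n → g x < N) ∧
    (∀ x, x < n → h₁ x < N) ∧ (∀ x, x < n → h₂ x < N) ∧
    (∀ x y, x < n → y < n → f x = f y → x = y) ∧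
    (∀ x y, x < n → y < n → g x = g y → x = y) ∧
    (∀ x y, x < n → y < n → h₁ x = h₁ y → x = y) ∧
    (∀ x y, x < n → y < n → h₂ x = h₂ y → x = y) ∧
    (∀ r c e, (r, c, e) ∈ P → L₁ (f r) (g c) = h₁ e) ∧
    (∀ r c e, (r, c, e) ∈ Q → L₂ (f r) (g c) = h₂ e)

open Function

/-- Orthogonal array. -/
def IsOA {K X : Type} (A : X × X → K → X) : Prop :=
  ∀ a b, a ≠ b → Injective fun p => (A p a, A p b)

def HasOA (k m : ℕ) : Prop := ∃ A : Fin m × Fin m → Fin k → Fin m, IsOA A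

/-- The set of quadruples `Z` embeds in an orthogonal array with four columns on `X`. -/
def Emb (X : Type) (n : ℕ) (Z : Set (Fin 4 → Fin n)) : Prop :=
  ∃ A : X × X → Fin 4 → X, IsOA A ∧ ∃ φ : Fin 4 → Fin n → X,
    (∀ k, Injective (φ k)) ∧ ∀ z ∈ Z, ∃ p, ∀ k, A p k = φ k (z k)

theorem isOA_transport {K X Y : Type} (e : X ≃ Y) {A : X × X → K → X} (h : IsOA A) :
    IsOA (fun (p : Y × Y) k => e (A (e.symm p.1, e.symm p.2) k)) := by
  intro a b hab p q hpq
  have h1 : A (e.symm p.1, e.symm p.2) a = A (e.symm q.1, e.symm q.2) a :=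
    e.injective (congrArg Prod.fst hpq)
  have h2 : A (e.symm p.1, e.symm p.2) b = A (e.symm q.1, e.symm q.2) b :=
    e.injective (congrArg Prod.snd hpq)
  have h3 := h a b hab (Prod.ext h1 h2)
  have h4 : e.symm p.1 = e.symm q.1 := congrArg Prod.fst h3
  have h5 : e.symm p.2 = e.symm q.2 := congrArg Prod.snd h3
  exact Prod.ext (e.symm.injective h4) (e.symm.injective h5)

theorem Emb.transport {X Y : Type} {n : ℕ} {Z : Set (Fin 4 → Fin n)} (e : X ≃ Y)
    (h : Emb X n Z) : Emb Y n Z := by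
  obtain ⟨A, hA, φ, hφ, hz⟩ := h
  refine ⟨_, isOA_transport e hA, fun k i => e (φ k i), fun k => e.injective.comp (hφ k), ?_⟩
  intro z hzZ
  obtain ⟨p, hp⟩ := hz z hzZ
  refine ⟨(e p.1, e p.2), fun k => ?_⟩
  simp [hp]

theorem HasOA.of_type {X : Type} [Fintype X] {k m : ℕ} (hc : Fintype.card X = m)
    {A : X × X → Fin k → X} (h : IsOA A) : HasOA k m :=
  ⟨_, isOA_transport (Fintype.equivFinOfCardEq hc) h⟩

theorem HasOA.mul {k m m' : ℕ} (h : HasOA k m) (h' : HasOA k m') : HasOA k (m * m') := by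
  obtain ⟨A, hA⟩ := h
  obtain ⟨B, hB⟩ := h'
  refine HasOA.of_type (X := Fin m × Fin m') (by simp)
    (A := fun p i => (A (p.1.1, p.2.1) i, B (p.1.2, p.2.2) i)) ?_
  rintro a b hab ⟨⟨x, x'⟩, y, y'⟩ ⟨⟨u, u'⟩, v, v'⟩ h
  simp only [Prod.mk.injEq] at h
  have h1 := hA a b hab (a₁ := (x, y)) (a₂ := (u, v)) (Prod.ext h.1.1 h.2.1)
  have h2 := hB a b hab (a₁ := (x', y')) (a₂ := (u', v')) (Prod.ext h.1.2 h.2.2)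
  simp_all

theorem HasOA.one (k : ℕ) : HasOA k 1 := by
  refine ⟨fun _ _ => 0, fun a b _ p q _ => Subsingleton.elim _ _⟩

theorem HasOA.zero (k : ℕ) : HasOA k 0 := by
  refine ⟨fun p _ => p.1, fun a b _ p => p.1.elim0⟩

theorem HasOA.of_field (F : Type) [Field F] [Fintype F] {k : ℕ} (hk : k ≤ Fintype.card F + 1) :
    HasOA k (Fintype.card F) := by
  classical
  obtain ⟨ι⟩ : Nonempty (Fin k ↪ Option F) := by
    apply Function.Embedding.nonempty_of_card_le
    simpa using hk
  refine HasOA.of_type (X := F) rfl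
    (A := fun p i => (ι i).elim p.2 (fun α => p.1 + α * p.2)) ?_
  rintro a b hab ⟨x, y⟩ ⟨u, v⟩ h
  have hne : ι a ≠ ι b := fun h => hab (ι.injective h)
  simp only [Prod.mk.injEq] at h
  obtain ⟨h1, h2⟩ := h
  rcases ha : ι a with _ | α <;> rcases hb : ι b with _ | β <;> rw [ha] at hne h1 <;>
    rw [hb] at hne h2 <;> simp at hne h1 h2
  · subst h1; simpa using h2
  · subst h2; simpa using h1
  · have h3 : (α - β) * (y - v) = 0 := by linear_combination h1 - h2
    have h4 : y = v := by
      rcases mul_eq_zero.1 h3 with h | h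
      · exact absurd (sub_eq_zero.1 h) hne
      · exact sub_eq_zero.1 h
    subst h4; simpa using h1

theorem HasOA.prime {k p : ℕ} (hp : p.Prime) (hk : k ≤ p + 1) : HasOA k p := by
  have := Fact.mk hp
  have := HasOA.of_field (ZMod p) (k := k) (by simpa [ZMod.card] using hk)
  simpa [ZMod.card] using this

theorem HasOA.primePow {k p e : ℕ} (hp : p.Prime) (he : e ≠ 0) (hk : k ≤ p ^ e + 1) :
    HasOA k (p ^ e) := by
  have := Fact.mk hp
  letI := Fintype.ofFinite (GaloisField p e)
  have hc : Fintype.card (GaloisField p e) = p ^ e := by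
    rw [← Nat.card_eq_fintype_card, GaloisField.card p e he]
  have := HasOA.of_field (GaloisField p e) (k := k) (by rw [hc]; exact hk)
  rwa [hc] at this

/-- All prime factors large. -/
theorem HasOA.of_primes {k : ℕ} : ∀ m : ℕ, m ≠ 0 → (∀ p, p.Prime → p ∣ m → k ≤ p + 1) →
    HasOA k m := by
  intro m
  induction m using Nat.recOnMul with
  | zero => intro h; exact absurd rfl h
  | one => intro _ _; exact HasOA.one k
  | prime p hp => intro _ h; exact HasOA.prime hp (h p hp dvd_rfl)
  | mul a b ha hb =>
    intro h0 h
    exact HasOA.mul (ha (by rintro rfl; simp at h0) fun p hp hd => h p hp (hd.mul_right _))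
      (hb (by rintro rfl; simp at h0) fun p hp hd => h p hp (hd.mul_left _))

theorem HasOA.four {x : ℕ} (hx : x % 4 ≠ 2) : HasOA 4 x := by
  rcases Nat.eq_zero_or_pos x with rfl | hpos
  · exact HasOA.zero 4
  obtain ⟨e, o, ho, rfl⟩ := Nat.exists_eq_two_pow_mul_odd hpos.ne'
  have h1 : HasOA 4 o := by
    refine HasOA.of_primes o (by rintro rfl; simp at ho) fun p hp hd => ?_
    have : p ≠ 2 := by
      rintro rfl
      obtain ⟨r, hr⟩ := ho
      omega
    have := hp.two_le
    omega
  have h2 : HasOA 4 (2 ^ e) := by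
    match e, hx with
    | 0, _ => simpa using HasOA.one 4
    | 1, hx =>
      obtain ⟨r, hr⟩ := ho
      omega
    | e + 2, _ =>
      apply HasOA.primePow Nat.prime_two (by omega)
      have : 1 ≤ 2 ^ e := Nat.one_le_two_pow
      rw [pow_add]; omega
  exact h2.mul h1

theorem HasOA.nine {m : ℕ} (h2 : m % 2 ≠ 0) (h3 : m % 3 ≠ 0) (h5 : m % 5 ≠ 0) (h7 : m % 7 ≠ 0) :
    HasOA 9 m := by
  refine HasOA.of_primes m (by rintro rfl; simp at h2) fun p hp hd => ?_
  by_contra hlt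
  have hp8 : p < 8 := by omega
  have := hp.two_le
  interval_cases p <;> first | omega | (revert hp; norm_num)

/-- Idempotent orthogonal arrays. -/
theorem idem_field (F : Type) [Field F] [Fintype F] (hF : 4 ≤ Fintype.card F) :
    ∃ D : F × F → Fin 4 → F, IsOA D ∧ ∀ i k, D (i, i) k = i := by
  classical
  obtain ⟨ι⟩ : Nonempty (Fin 4 ↪ F) := by
    apply Function.Embedding.nonempty_of_card_le
    simpa using hF
  refine ⟨fun p i => ι i * p.1 + (1 - ι i) * p.2, ?_, fun i k => by ring⟩
  rintro a b hab ⟨x, y⟩ ⟨u, v⟩ h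
  have hne : ι a ≠ ι b := fun h => hab (ι.injective h)
  simp only [Prod.mk.injEq] at h
  obtain ⟨h1, h2⟩ := h
  have h3 : (ι a - ι b) * ((x - y) - (u - v)) = 0 := by linear_combination h1 - h2
  have h4 : (x - y) - (u - v) = 0 := by
    rcases mul_eq_zero.1 h3 with h | h
    · exact absurd (sub_eq_zero.1 h) hne
    · exact h
  have h5 : y = v := by linear_combination h1 - ι a * h4
  have h6 : x = u := by linear_combination h4 + h5
  rw [h5, h6]

theorem idem_primePow {p e : ℕ} (hp : p.Prime) (he : e ≠ 0) (h4 : 4 ≤ p ^ e) (I : Type) [Fintype I]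
    (hI : Fintype.card I = p ^ e) :
    ∃ D : I × I → Fin 4 → I, IsOA D ∧ ∀ i k, D (i, i) k = i := by
  have := Fact.mk hp
  letI := Fintype.ofFinite (GaloisField p e)
  have hc : Fintype.card (GaloisField p e) = p ^ e := by
    rw [← Nat.card_eq_fintype_card, GaloisField.card p e he]
  obtain ⟨D, hD, hi⟩ := idem_field (GaloisField p e) (by omega)
  let eq : GaloisField p e ≃ I := Fintype.equivOfCardEq (by omega)
  refine ⟨_, isOA_transport eq hD, fun i k => ?_⟩
  simp [hi]

theorem idem_small (I : Type) [Fintype I] (h7 : 7 ≤ Fintype.card I) (h9 : Fintype.card I ≤ 9) :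
    ∃ D : I × I → Fin 4 → I, IsOA D ∧ ∀ i k, D (i, i) k = i := by
  obtain h | h | h : Fintype.card I = 7 ^ 1 ∨ Fintype.card I = 2 ^ 3 ∨ Fintype.card I = 3 ^ 2 := by
    omega
  · exact idem_primePow (by norm_num) (by norm_num) (by norm_num) I h
  · exact idem_primePow (by norm_num) (by norm_num) (by norm_num) I h
  · exact idem_primePow (by norm_num) (by norm_num) (by norm_num) I h


theorem filler {k m : ℕ} (hk7 : 7 ≤ k) (hk9 : k ≤ 9) (hT : HasOA k m) (s : Fin k → ℕ)
    (hs : ∀ g, s g ≤ m) (hs7 : ∀ g : Fin k, g.1 < 7 → s g = m) (hB : ∀ g, HasOA 4 (s g))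
    (g₀ : Fin k) {n : ℕ} {Z : Set (Fin 4 → Fin n)} (hZ : Emb (Fin (s g₀)) n Z) :
    Emb (Σ g : Fin k, Fin (s g)) n Z := by
  classical
  obtain ⟨T, hT⟩ := hT
  obtain ⟨B₀, hB₀, φ, hφ, hz⟩ := hZ
  have hB' : ∀ g, ∃ B : Fin (s g) × Fin (s g) → Fin 4 → Fin (s g), IsOA B ∧
      ∀ h : g = g₀, ∀ p q : Fin (s g₀), ∀ j, B (h ▸ p, h ▸ q) j = h ▸ B₀ (p, q) j := by
    intro g
    by_cases h : g = g₀
    · subst h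
      exact ⟨B₀, hB₀, fun _ _ _ _ => rfl⟩
    · obtain ⟨B, hB⟩ := hB g
      exact ⟨B, hB, fun h' => absurd h' h⟩
  choose B hB hBg using hB'
  let I : Fin m × Fin m → Type := fun u => {l : Fin k // (T u l).val < s l}
  have hD : ∀ u, ∃ D : I u × I u → Fin 4 → I u, IsOA D ∧ ∀ i j, D (i, i) j = i := by
    intro u
    apply idem_small
    · have : Fintype.card (Fin 7) ≤ Fintype.card (I u) := by
        refine Fintype.card_le_of_injective
          (fun i => (⟨Fin.castLE hk7 i, ?_⟩ : I u)) ?_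
        · rw [hs7 _ i.2]; exact (T u _).2
        · intro i j hij
          have := congrArg Subtype.val hij
          exact Fin.castLE_injective hk7 this
      simpa using this
    · have : Fintype.card (I u) ≤ Fintype.card (Fin k) := Fintype.card_subtype_le _
      simp only [Fintype.card_fin] at this
      omega
  choose D hD hDi using hD
  let pt : ∀ u, I u → (Σ g : Fin k, Fin (s g)) := fun u l => ⟨l.1, ⟨(T u l.1).val, l.2⟩⟩
  have hpt : ∀ u, Injective (pt u) := by
    intro u i j h
    exact Subtype.ext (congrArg Sigma.fst h)
  have hptv : ∀ u u' (i : I u) (i' : I u'), pt u i = pt u' i' → i.1 = i'.1 ∧ T u i.1 = T u' i.1 := by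
    rintro u u' ⟨i, hi⟩ ⟨i', hi'⟩ h
    simp only [pt, Sigma.mk.inj_iff] at h
    obtain ⟨h1, h2⟩ := h
    subst h1
    refine ⟨rfl, Fin.ext ?_⟩
    simpa using h2
  have hA : ∀ P : (Σ g : Fin k, Fin (s g)) × (Σ g : Fin k, Fin (s g)),
      ∃ v : Fin 4 → (Σ g : Fin k, Fin (s g)),
      (∃ g p q, P = (⟨g, p⟩, ⟨g, q⟩) ∧ v = fun j => ⟨g, B g (p, q) j⟩) ∨
      (∃ u, ∃ i i' : I u, i ≠ i' ∧ P = (pt u i, pt u i') ∧ v = fun j => pt u (D u (i, i') j)) := by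
    rintro ⟨⟨g, p⟩, ⟨g', q⟩⟩
    by_cases h : g = g'
    · subst h
      exact ⟨_, Or.inl ⟨g, p, q, rfl, rfl⟩⟩
    · have hsurj := Finite.surjective_of_injective (hT g g' h)
      obtain ⟨u, hu⟩ := hsurj (Fin.castLE (hs g) p, Fin.castLE (hs g') q)
      simp only [Prod.mk.injEq] at hu
      refine ⟨_, Or.inr ⟨u, ⟨g, ?_⟩, ⟨g', ?_⟩, ?_, ?_, rfl⟩⟩
      · rw [hu.1]; exact p.2
      · rw [hu.2]; exact q.2
      · intro h'; exact h (congrArg Subtype.val h')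
      · simp [pt, hu.1, hu.2]
  choose A hA using hA
  have mixed : ∀ (g : Fin k) (p q : Fin (s g)) u (i i' : I u) (a b : Fin 4), a ≠ b → i ≠ i' →
      (⟨g, p⟩ : Σ g : Fin k, Fin (s g)) = pt u (D u (i, i') a) →
      (⟨g, q⟩ : Σ g : Fin k, Fin (s g)) = pt u (D u (i, i') b) → False := by
    intro g p q u i i' a b hab hne h1 h2
    have e1 : g = (D u (i, i') a).1 := congrArg Sigma.fst h1
    have e2 : g = (D u (i, i') b).1 := congrArg Sigma.fst h2
    have e3 : D u (i, i') a = D u (i, i') b := Subtype.ext (e1.symm.trans e2)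
    have e4 := hD u a b hab (a₁ := (i, i')) (a₂ := (D u (i, i') a, D u (i, i') a))
      (by simp only [hDi]; rw [← e3])
    simp only [Prod.mk.injEq] at e4
    exact hne (e4.1.trans e4.2.symm)
  refine ⟨A, ?_, fun j i => ⟨g₀, φ j i⟩, ?_, ?_⟩
  · intro a b hab P Q hPQ
    simp only [Prod.mk.injEq] at hPQ
    obtain ⟨h1, h2⟩ := hPQ
    rcases hA P with ⟨g, p, q, hP, hv⟩ | ⟨u, i, i', hne, hP, hv⟩ <;>
    rcases hA Q with ⟨g', p', q', hQ, hv'⟩ | ⟨u', j, j', hne', hQ, hv'⟩ <;>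
    rw [hv, hv'] at h1 h2 <;> rw [hP, hQ] <;> simp only at h1 h2
    · have hg : g = g' := congrArg Sigma.fst h1
      subst hg
      simp only [Sigma.mk.inj_iff, heq_eq_eq, true_and] at h1 h2
      have := hB g a b hab (a₁ := (p, q)) (a₂ := (p', q')) (Prod.ext h1 h2)
      simp only [Prod.mk.injEq] at this
      rw [this.1, this.2]
    · exact (mixed _ _ _ _ _ _ _ _ hab hne' h1 h2).elim
    · exact (mixed _ _ _ _ _ _ _ _ hab hne h1.symm h2.symm).elim
    · obtain ⟨e1, f1⟩ := hptv _ _ _ _ h1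
      obtain ⟨e2, f2⟩ := hptv _ _ _ _ h2
      have hdif : (D u (i, i') a).1 ≠ (D u (i, i') b).1 := by
        intro h
        exact mixed (D u (i, i') a).1 (pt u (D u (i, i') a)).2
          (h ▸ (pt u (D u (i, i') b)).2) u i i' a b hab hne rfl
          (by
            have : D u (i, i') a = D u (i, i') b := Subtype.ext h
            generalize D u (i, i') a = x at *
            generalize D u (i, i') b = y at *
            subst this; rfl)
      have huu : u = u' := hT _ _ hdif (Prod.ext f1 f2)
      subst huu
      have e3 := hD u a b hab (a₁ := (i, i')) (a₂ := (j, j'))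
        (Prod.ext (Subtype.ext e1) (Subtype.ext e2))
      simp only [Prod.mk.injEq] at e3
      rw [e3.1, e3.2]
  · intro j x y h
    simp only [Sigma.mk.inj_iff, heq_eq_eq, true_and] at h
    exact hφ j h
  · intro z hzZ
    obtain ⟨p, hp⟩ := hz z hzZ
    refine ⟨(⟨g₀, p.1⟩, ⟨g₀, p.2⟩), fun j => ?_⟩
    rcases hA (⟨g₀, p.1⟩, ⟨g₀, p.2⟩) with ⟨g, x, y, hP, hv⟩ | ⟨u, i, i', hne, hP, hv⟩
    · rw [hv]
      simp only [Prod.mk.injEq] at hP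
      obtain ⟨hp1, hp2⟩ := hP
      have hg : g₀ = g := congrArg Sigma.fst hp1
      subst hg
      simp only [Sigma.mk.inj_iff, heq_eq_eq, true_and] at hp1 hp2
      subst hp1 hp2
      simp only [Sigma.mk.inj_iff, heq_eq_eq, true_and]
      rw [← hp j]
      exact hBg g₀ rfl p.1 p.2 j
    · exfalso
      simp only [Prod.mk.injEq] at hP
      apply hne
      apply Subtype.ext
      have e1 : g₀ = i.1 := congrArg Sigma.fst hP.1
      have e2 : g₀ = i'.1 := congrArg Sigma.fst hP.2
      exact e1.symm.trans e2

theorem emb_zero_iff {N n : ℕ} {X : Type} [Fintype X] {Z : Set (Fin 4 → Fin n)}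
    (hc : Fintype.card X = N) (h : Emb X n Z) : Emb (Fin N) n Z :=
  h.transport (Fintype.equivFinOfCardEq hc)

/-- sizes `m` (seven times), `x`, `y`; structure in the last group -/
theorem filler_last {m x y t n : ℕ} {Z : Set (Fin 4 → Fin n)} (hT : HasOA 9 m) (hm : HasOA 4 m)
    (hx : HasOA 4 x) (hxm : x ≤ m) (hym : y ≤ m) (hy : Emb (Fin y) n Z)
    (ht : t = 7 * m + x + y) : Emb (Fin t) n Z := by
  have h := filler (k := 9) (by norm_num) le_rfl hT ![m, m, m, m, m, m, m, x, y]
    (by intro g; fin_cases g <;> simp [hxm, hym])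
    (by intro g hg; fin_cases g <;> simp at hg ⊢)
    (by
      obtain ⟨A, hA, _⟩ := hy
      intro g; fin_cases g <;> first | exact hm | exact hx | exact ⟨A, hA⟩) 8 (n := n) (Z := Z) hy
  refine emb_zero_iff ?_ h
  simp [Fin.sum_univ_succ]
  omega

/-- structure in a full group -/
theorem filler_first {m x y t n : ℕ} {Z : Set (Fin 4 → Fin n)} (hT : HasOA 9 m)
    (hx : HasOA 4 x) (hy : HasOA 4 y) (hxm : x ≤ m) (hym : y ≤ m) (hm : Emb (Fin m) n Z)
    (ht : t = 7 * m + x + y) : Emb (Fin t) n Z := by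
  have h := filler (k := 9) (by norm_num) le_rfl hT ![m, m, m, m, m, m, m, x, y]
    (by intro g; fin_cases g <;> simp [hxm, hym])
    (by intro g hg; fin_cases g <;> simp at hg ⊢)
    (by
      obtain ⟨A, hA, _⟩ := hm
      intro g; fin_cases g <;> first | exact ⟨A, hA⟩ | exact hx | exact hy) 0 (n := n) (Z := Z) hm
  refine emb_zero_iff ?_ h
  simp [Fin.sum_univ_succ]
  omega

/-- eight groups -/
theorem filler_eight {m x t n : ℕ} {Z : Set (Fin 4 → Fin n)} (hT : HasOA 8 m)
    (hx : HasOA 4 x) (hxm : x ≤ m) (hm : Emb (Fin m) n Z)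
    (ht : t = 7 * m + x) : Emb (Fin t) n Z := by
  have h := filler (k := 8) (by norm_num) (by norm_num) hT ![m, m, m, m, m, m, m, x]
    (by intro g; fin_cases g <;> simp [hxm])
    (by intro g hg; fin_cases g <;> simp at hg ⊢)
    (by
      obtain ⟨A, hA, _⟩ := hm
      intro g; fin_cases g <;> first | exact ⟨A, hA⟩ | exact hx) 0 (n := n) (Z := Z) hm
  refine emb_zero_iff ?_ h
  simp [Fin.sum_univ_succ]
  omega


theorem split_sum {m s : ℕ} (h : s + 2 ≤ 2 * m ∨ (m % 4 = 0 ∧ s + 1 ≤ 2 * m)) :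
    ∃ x y, x ≤ m ∧ y ≤ m ∧ x + y = s ∧ x % 4 ≠ 2 ∧ y % 4 ≠ 2 := by
  by_cases h1 : (s / 2) % 4 ≠ 2 ∧ (s - s / 2) % 4 ≠ 2
  · exact ⟨s - s / 2, s / 2, by omega, by omega, by omega, h1.2, h1.1⟩
  · exact ⟨s - s / 2 + 1, s / 2 - 1, by omega, by omega, by omega, by omega, by omega⟩

theorem fill_range {m t n : ℕ} {Z : Set (Fin 4 → Fin n)} (hT : HasOA 9 m) (hm : Emb (Fin m) n Z)
    (h7 : 7 * m ≤ t) (h9 : t + 2 ≤ 9 * m ∨ (m % 4 = 0 ∧ t + 1 ≤ 9 * m)) : Emb (Fin t) n Z := by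
  obtain ⟨x, y, hx, hy, hs, hx2, hy2⟩ := split_sum (m := m) (s := t - 7 * m) (by omega)
  exact filler_first hT (HasOA.four hx2) (HasOA.four hy2) hx hy hm (by omega)

theorem good_m_res : ∀ a : Fin 3, ∀ b : Fin 5, ∀ c : Fin 7, ∃ u : Fin 6,
    (a.1 + 4 * u.1) % 3 ≠ 0 ∧ (b.1 + 4 * u.1) % 5 ≠ 0 ∧ (c.1 + 4 * u.1) % 7 ≠ 0 := by
  decide

theorem good_m_aux : ∀ N < 420, ∀ ρ < 2, ∃ j < 24, (N + j) % 4 = 2 * ρ + 1 ∧ (N + j) % 3 ≠ 0 ∧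
    (N + j) % 5 ≠ 0 ∧ (N + j) % 7 ≠ 0 := by
  intro N _ ρ hρ
  obtain ⟨i, hi, h4⟩ : ∃ i < 4, (N + i) % 4 = 2 * ρ + 1 := by
    refine ⟨(2 * ρ + 1 + 3 * N) % 4, by omega, by omega⟩
  obtain ⟨⟨u, hu⟩, h3, h5, h7⟩ := good_m_res ⟨(N + i) % 3, by omega⟩ ⟨(N + i) % 5, by omega⟩
    ⟨(N + i) % 7, by omega⟩
  simp only at h3 h5 h7
  exact ⟨i + 4 * u, by omega, by omega, by omega, by omega, by omega⟩

theorem good_m (N ρ : ℕ) (hρ : ρ < 2) : ∃ m, N ≤ m ∧ m < N + 24 ∧ m % 4 = 2 * ρ + 1 ∧ m % 3 ≠ 0 ∧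
    m % 5 ≠ 0 ∧ m % 7 ≠ 0 := by
  obtain ⟨j, hj, h⟩ := good_m_aux (N % 420) (Nat.mod_lt _ (by norm_num)) ρ hρ
  exact ⟨N + j, by omega, by omega, by omega, by omega, by omega, by omega⟩

theorem fill_large {M t n : ℕ} {Z : Set (Fin 4 → Fin n)} (hM : Emb (Fin M) n Z)
    (ht : 1600 ≤ t) (h9 : 9 * M ≤ t) : Emb (Fin t) n Z := by
  obtain ⟨ρ, hρ, hρ2⟩ : ∃ ρ < 2, (t - M + (2 * ρ + 1)) % 4 ≠ 2 := by
    by_cases h : (t - M + (2 * 0 + 1)) % 4 ≠ 2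
    · exact ⟨0, by norm_num, h⟩
    · exact ⟨1, by norm_num, by omega⟩
  obtain ⟨m, h1, h2, h3, h4, h5, h6⟩ := good_m ((t - M + 7) / 8) ρ hρ
  refine filler_last (m := m) (x := t - M - 7 * m) (y := M) (HasOA.nine (by omega) h4 h5 h6)
    (HasOA.four (by omega)) (HasOA.four (by omega)) (by omega) (by omega) hM (by omega)

theorem emb_of_oa_one {N n : ℕ} {Z : Set (Fin 4 → Fin n)} (hN : 0 < N) (hn : n ≤ 1)
    (h : HasOA 4 N) : Emb (Fin N) n Z := by
  obtain ⟨A, hA⟩ := h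
  refine ⟨A, hA, fun k _ => A (⟨0, hN⟩, ⟨0, hN⟩) k, ?_, ?_⟩
  · intro k x y _
    apply Fin.ext; omega
  · intro z _
    exact ⟨_, fun k => rfl⟩

theorem HasOA.of_emb {N n : ℕ} {Z : Set (Fin 4 → Fin n)} (h : Emb (Fin N) n Z) : HasOA 4 N := by
  obtain ⟨A, hA, _⟩ := h
  exact ⟨A, hA⟩

theorem oa_step {m t : ℕ} (hT : HasOA 9 m) (hm : m % 4 ≠ 2) (h7 : 7 * m ≤ t)
    (h9 : t + 2 ≤ 9 * m) : HasOA 4 t :=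
  HasOA.of_emb (n := 1) (Z := ∅) (fill_range hT
    (emb_of_oa_one (by omega) le_rfl (HasOA.four hm)) h7 (Or.inl h9))

theorem oa_step' {m t : ℕ} (h2 : m % 2 ≠ 0) (h3 : m % 3 ≠ 0) (h5 : m % 5 ≠ 0) (hh7 : m % 7 ≠ 0)
    (h7 : 7 * m ≤ t) (h9 : t + 2 ≤ 9 * m) : HasOA 4 t :=
  oa_step (HasOA.nine h2 h3 h5 hh7) (by omega) h7 h9

/-- Two orthogonal latin squares of every order at least 48. -/
theorem oa_all {t : ℕ} (ht : 48 ≤ t) : HasOA 4 t := by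
  by_cases h4 : t % 4 ≠ 2
  · exact HasOA.four h4
  by_cases hl : 1600 ≤ t
  · exact HasOA.of_emb (n := 1) (Z := ∅) (fill_large (M := 1)
      (emb_of_oa_one one_pos le_rfl (HasOA.one 4)) hl (by omega))
  have hsm : t < 56 → HasOA 4 t := by
    intro h
    refine HasOA.of_emb (n := 1) (Z := ∅) (filler_eight (m := 7) (x := t - 49)
      (HasOA.prime (by norm_num) (by norm_num)) (HasOA.four (by omega)) (by omega)
      (emb_of_oa_one (by omega) le_rfl (HasOA.four (by norm_num))) (by omega))
  by_cases c0 : t < 56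
  · exact hsm c0
  by_cases c1 : t ≤ 70
  · exact oa_step (m := 8) (HasOA.primePow (p := 2) (e := 3) Nat.prime_two (by norm_num)
      (by norm_num)) (by norm_num) (by omega) (by omega)
  by_cases c2 : t ≤ 76
  · exact oa_step (m := 9) (HasOA.primePow (p := 3) (e := 2) Nat.prime_three (by norm_num)
      (by norm_num)) (by norm_num) (by omega) (by omega)
  by_cases c : t ≤ 97
  · exact oa_step' (m := 11) (by norm_num) (by norm_num) (by norm_num) (by norm_num) (by omega) (by omega)
  by_cases c : t ≤ 115
  · exact oa_step' (m := 13) (by norm_num) (by norm_num) (by norm_num) (by norm_num) (by omega) (by omega)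
  by_cases c : t ≤ 140
  · exact oa_step (m := 16) (HasOA.primePow (p := 2) (e := 4) Nat.prime_two (by norm_num)
      (by norm_num)) (by norm_num) (by omega) (by omega)
  obtain ⟨m, hm⟩ : ∃ m, m % 2 ≠ 0 ∧ m % 3 ≠ 0 ∧ m % 5 ≠ 0 ∧ m % 7 ≠ 0 ∧ 7 * m ≤ t ∧ t + 2 ≤ 9 * m := by
    by_cases c : t ≤ 169
    · exact ⟨19, by omega⟩
    by_cases c : t ≤ 205
    · exact ⟨23, by omega⟩
    by_cases c : t ≤ 259
    · exact ⟨29, by omega⟩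
    by_cases c : t ≤ 331
    · exact ⟨37, by omega⟩
    by_cases c : t ≤ 421
    · exact ⟨47, by omega⟩
    by_cases c : t ≤ 529
    · exact ⟨59, by omega⟩
    by_cases c : t ≤ 655
    · exact ⟨73, by omega⟩
    by_cases c : t ≤ 799
    · exact ⟨89, by omega⟩
    by_cases c : t ≤ 1015
    · exact ⟨113, by omega⟩
    by_cases c : t ≤ 1249
    · exact ⟨139, by omega⟩
    by_cases c : t ≤ 1555
    · exact ⟨173, by omega⟩
    exact ⟨209, by omega⟩
  exact oa_step' hm.1 hm.2.1 hm.2.2.1 hm.2.2.2.1 hm.2.2.2.2.1 hm.2.2.2.2.2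


theorem emb_linear {F V : Type} [Field F] [AddCommGroup V] [Module F V] (a : F) (ha0 : a ≠ 0)
    (ha1 : a ≠ 1) {n : ℕ} (Z : Set (Fin 4 → Fin n)) (φ : Fin 4 → Fin n → V)
    (hφ : ∀ k, Injective (φ k)) (W : (Fin 4 → Fin n) → Submodule F V)
    (hW1 : ∀ z ∈ Z, φ 2 (z 2) - φ 0 (z 0) - φ 1 (z 1) ∈ W z)
    (hW2 : ∀ z ∈ Z, φ 3 (z 3) - φ 0 (z 0) - a • φ 1 (z 1) ∈ W z)
    (hdis : ∀ z ∈ Z, ∀ z' ∈ Z, ∀ x y : V, x - φ 0 (z 0) ∈ W z → y - φ 1 (z 1) ∈ W z →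
      x - φ 0 (z' 0) ∈ W z' → y - φ 1 (z' 1) ∈ W z' → z = z') : Emb V n Z := by
  classical
  let reg : (Fin 4 → Fin n) → V × V → Prop := fun z p =>
    z ∈ Z ∧ p.1 - φ 0 (z 0) ∈ W z ∧ p.2 - φ 1 (z 1) ∈ W z
  let α : Fin 4 → F := ![1, 0, 1, 1]
  let β : Fin 4 → F := ![0, 1, 1, a]
  let S : (Fin 4 → Fin n) → Fin 4 → V := fun z => ![0, 0, φ 2 (z 2) - φ 0 (z 0) - φ 1 (z 1),
    φ 3 (z 3) - φ 0 (z 0) - a • φ 1 (z 1)]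
  have hS : ∀ z ∈ Z, ∀ k, S z k ∈ W z := by
    intro z hz k
    fin_cases k
    · exact (W z).zero_mem
    · exact (W z).zero_mem
    · exact hW1 z hz
    · exact hW2 z hz
  have hδ : ∀ p : V × V, ∃ δ : Fin 4 → V, (∃ z, reg z p ∧ δ = S z) ∨ ((∀ z, ¬ reg z p) ∧ δ = 0) := by
    intro p
    by_cases h : ∃ z, reg z p
    · obtain ⟨z, hz⟩ := h
      exact ⟨S z, Or.inl ⟨z, hz, rfl⟩⟩
    · push Not at h
      exact ⟨0, Or.inr ⟨h, rfl⟩⟩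
  choose δ hδ using hδ
  have huniq : ∀ z z' p, reg z p → reg z' p → z = z' := fun z z' p h h' =>
    hdis z h.1 z' h'.1 p.1 p.2 h.2.1 h.2.2 h'.2.1 h'.2.2
  have hdet : ∀ k l, k ≠ l → α k * β l - α l * β k ≠ 0 := by
    have ha1' : a - 1 ≠ 0 := sub_ne_zero.2 ha1
    have ha1'' : 1 - a ≠ 0 := sub_ne_zero.2 ha1.symm
    intro k l hkl
    fin_cases k <;> fin_cases l <;> simp [α, β, ha0, ha1', ha1''] at hkl ⊢
  refine ⟨fun p k => α k • p.1 + β k • p.2 + δ p k, ?_, φ, hφ, ?_⟩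
  · intro k l hkl p q hpq
    simp only [Prod.mk.injEq] at hpq
    obtain ⟨h1, h2⟩ := hpq
    have hd := hdet k l hkl
    set d := α k * β l - α l * β k with hdd
    let R : V × V → V × V := fun p =>
      (p.1 + d⁻¹ • (β l • δ p k - β k • δ p l), p.2 + d⁻¹ • (α k • δ p l - α l • δ p k))
    have key1 : ∀ p : V × V, d • (R p).1 =
        β l • (α k • p.1 + β k • p.2 + δ p k) - β k • (α l • p.1 + β l • p.2 + δ p l) := by
      intro p
      simp only [R, smul_add, smul_smul, mul_inv_cancel₀ hd, one_smul]
      rw [hdd]; module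
    have key2 : ∀ p : V × V, d • (R p).2 =
        α k • (α l • p.1 + β l • p.2 + δ p l) - α l • (α k • p.1 + β k • p.2 + δ p k) := by
      intro p
      simp only [R, smul_add, smul_smul, mul_inv_cancel₀ hd, one_smul]
      rw [hdd]; module
    have hR : R p = R q := by
      refine Prod.ext (smul_right_injective V hd ?_) (smul_right_injective V hd ?_)
      · simp only [key1, h1, h2]
      · simp only [key2, h1, h2]
    have hreg : ∀ p z, reg z p → δ p = S z → reg z (R p) := by
      intro p z hz hpz
      refine ⟨hz.1, ?_, ?_⟩
      · have : (R p).1 - φ 0 (z 0) = (p.1 - φ 0 (z 0)) + d⁻¹ • (β l • S z k - β k • S z l) := by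
          simp only [R, hpz]; abel
        rw [this]
        exact (W z).add_mem hz.2.1 ((W z).smul_mem _ ((W z).sub_mem
          ((W z).smul_mem _ (hS z hz.1 k)) ((W z).smul_mem _ (hS z hz.1 l))))
      · have : (R p).2 - φ 1 (z 1) = (p.2 - φ 1 (z 1)) + d⁻¹ • (α k • S z l - α l • S z k) := by
          simp only [R, hpz]; abel
        rw [this]
        exact (W z).add_mem hz.2.2 ((W z).smul_mem _ ((W z).sub_mem
          ((W z).smul_mem _ (hS z hz.1 l)) ((W z).smul_mem _ (hS z hz.1 k))))
    have hnone : ∀ p, δ p = 0 → R p = p := by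
      intro p h
      simp [R, h]
    have hsame : δ p = δ q → p = q := by
      intro h
      have e1 : (R p).1 = (R q).1 := congrArg Prod.fst hR
      have e2 : (R p).2 = (R q).2 := congrArg Prod.snd hR
      simp only [R, h] at e1 e2
      exact Prod.ext (add_right_cancel e1) (add_right_cancel e2)
    rcases hδ p with ⟨z, hz, hp⟩ | ⟨hn, hp⟩ <;> rcases hδ q with ⟨z', hz', hq⟩ | ⟨hn', hq⟩
    · have := huniq z z' (R p) (hreg p z hz hp) (hR ▸ hreg q z' hz' hq)
      subst this
      exact hsame (hp.trans hq.symm)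
    · exfalso
      apply hn' z
      rw [← hnone q hq, ← hR]
      exact hreg p z hz hp
    · exfalso
      apply hn z'
      rw [← hnone p hp, hR]
      exact hreg q z' hz' hq
    · exact hsame (hp.trans hq.symm)
  · intro z hz
    refine ⟨(φ 0 (z 0), φ 1 (z 1)), ?_⟩
    have hr : reg z (φ 0 (z 0), φ 1 (z 1)) := ⟨hz, by simp, by simp⟩
    have hd : δ (φ 0 (z 0), φ 1 (z 1)) = S z := by
      rcases hδ (φ 0 (z 0), φ 1 (z 1)) with ⟨z', hz', hp⟩ | ⟨hn, _⟩
      · rw [hp, huniq z z' _ hr hz']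
      · exact absurd hr (hn z)
    intro k
    show α k • φ 0 (z 0) + β k • φ 1 (z 1) + δ (φ 0 (z 0), φ 1 (z 1)) k = _
    rw [hd]
    fin_cases k <;> simp [α, β, S]

theorem core_alg {F H : Type} [Field F] [AddCommGroup H] [Module F H] (a : F)
    (p γ η κ : H) (l m l' m' : F)
    (h01 : p = 0 → γ = 0 → False) (h02 : p = 0 → η = 0 → False) (h03 : p = 0 → κ = 0 → False)
    (h12 : γ = 0 → η = 0 → False) (h13 : γ = 0 → κ = 0 → False) (h23 : η = 0 → κ = 0 → False)
    (F1 : p = l • (p + γ) + m • (p + a • γ)) (F2 : p = l • (p - η) + m • p)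
    (F3 : p = l • p + m • (p - κ))
    (G1 : γ = l' • (p + γ) + m' • (p + a • γ)) (G2 : 0 = l' • (p - η) + m' • p)
    (G3 : 0 = l' • p + m' • (p - κ)) : False := by
  have G2' : l' • η = (l' + m') • p := by
    have : l' • η - (l' + m') • p = -(l' • (p - η) + m' • p) := by module
    rw [← G2, neg_zero] at this
    exact sub_eq_zero.1 this
  have G3' : m' • κ = (l' + m') • p := by
    have : m' • κ - (l' + m') • p = -(l' • p + m' • (p - κ)) := by module
    rw [← G3, neg_zero] at this
    exact sub_eq_zero.1 this
  have F2' : l • η = (l + m - 1) • p := by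
    have : l • η - (l + m - 1) • p = p - (l • (p - η) + m • p) := by module
    rw [← F2, sub_self] at this
    exact sub_eq_zero.1 this
  have F3' : m • κ = (l + m - 1) • p := by
    have : m • κ - (l + m - 1) • p = p - (l • p + m • (p - κ)) := by module
    rw [← F3, sub_self] at this
    exact sub_eq_zero.1 this
  have hG : l' = 0 → m' = 0 → γ = 0 := by
    rintro rfl rfl
    simpa using G1
  by_cases hp : p = 0
  · have hη : η ≠ 0 := fun h => h02 hp h
    have hκ : κ ≠ 0 := fun h => h03 hp h
    rw [hp, smul_zero] at G2' G3'
    exact h01 hp (hG ((smul_eq_zero.1 G2').resolve_right hη) ((smul_eq_zero.1 G3').resolve_right hκ))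
  by_cases hη : η = 0
  · have hκ : κ ≠ 0 := fun h => h23 hη h
    rw [hη, smul_zero] at G2'
    have ht := (smul_eq_zero.1 G2'.symm).resolve_right hp
    rw [ht, zero_smul] at G3'
    have hm := (smul_eq_zero.1 G3').resolve_right hκ
    exact h12 (hG (by rw [hm] at ht; simpa using ht) hm) hη
  by_cases hκ : κ = 0
  · rw [hκ, smul_zero] at G3'
    have ht := (smul_eq_zero.1 G3'.symm).resolve_right hp
    rw [ht, zero_smul] at G2'
    have hl := (smul_eq_zero.1 G2').resolve_right hη
    exact h13 (hG hl (by rw [hl] at ht; simpa using ht)) hκ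
  by_cases hγ : γ = 0
  · have h1 : (l + m - 1) • p = 0 := by
      have : (l + m - 1) • p = (l • (p + γ) + m • (p + a • γ)) - p := by rw [hγ]; module
      rw [this, ← F1, sub_self]
    have h2 := (smul_eq_zero.1 h1).resolve_right hp
    rw [h2, zero_smul] at F2' F3'
    have hl := (smul_eq_zero.1 F2').resolve_right hη
    have hm := (smul_eq_zero.1 F3').resolve_right hκ
    rw [hl, hm] at h2
    simp at h2
  -- all nonzero
  have ht : l' + m' ≠ 0 := by
    intro ht
    rw [ht, zero_smul] at G2' G3'
    exact hγ (hG ((smul_eq_zero.1 G2').resolve_right hη) ((smul_eq_zero.1 G3').resolve_right hκ))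
  have e1 : (l * (l' + m') - l' * (l + m - 1)) • p = 0 := by
    have : (l * (l' + m') - l' * (l + m - 1)) • p
        = l • ((l' + m') • p) - l' • ((l + m - 1) • p) := by module
    rw [this, ← G2', ← F2']; module
  have e2 : (m * (l' + m') - m' * (l + m - 1)) • p = 0 := by
    have : (m * (l' + m') - m' * (l + m - 1)) • p
        = m • ((l' + m') • p) - m' • ((l + m - 1) • p) := by module
    rw [this, ← G3', ← F3']; module
  have e1' := (smul_eq_zero.1 e1).resolve_right hp
  have e2' := (smul_eq_zero.1 e2).resolve_right hp
  exact ht (by linear_combination e1' + e2')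

/-- Quadruples agree in at most one coordinate. -/
def Dist3 {n : ℕ} (Z : Set (Fin 4 → Fin n)) : Prop :=
  ∀ z ∈ Z, ∀ z' ∈ Z, ∀ a b, a ≠ b → z a = z' a → z b = z' b → z = z'

theorem emb_field (F : Type) [Field F] [Fintype F] (hF : 3 ≤ Fintype.card F) (s : ℕ) {n : ℕ}
    (hn : n ≤ Fintype.card F ^ s) (Z : Set (Fin 4 → Fin n)) (hZ : Dist3 Z) :
    Emb (Fin (Fintype.card F ^ (3 * s + 2))) n Z := by
  classical
  obtain ⟨a, ha0, ha1⟩ : ∃ a : F, a ≠ 0 ∧ a ≠ 1 := by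
    by_contra h
    push Not at h
    have : (Finset.univ : Finset F) ⊆ {0, 1} := by
      intro x _
      by_cases hx : x = 0
      · simp [hx]
      · simp [h x hx]
    have h1 := Finset.card_le_card this
    have h2 := Finset.card_le_two (a := (0 : F)) (b := 1)
    rw [Finset.card_univ] at h1
    omega
  obtain ⟨ι⟩ : Nonempty (Fin n ↪ (Fin s → F)) := by
    apply Function.Embedding.nonempty_of_card_le
    simpa using hn
  have hι : ∀ x y, ι x - ι y = 0 → x = y := fun x y h => ι.injective (sub_eq_zero.1 h)
  let φ : Fin 4 → Fin n → (((Fin s → F) × (Fin s → F) × (Fin s → F)) × F × F) := ![fun r => ((ι r, ι r, ι r), 1, 0), fun c => ((ι c, 0, 0), 0, 1),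
    fun e => ((0, ι e, 0), 0, 0), fun e => ((0, 0, ι e), 0, 0)]
  have hφ : ∀ k, Injective (φ k) := by
    intro k x y h
    fin_cases k <;> simpa [φ] using h
  let W : (Fin 4 → Fin n) → Submodule F (((Fin s → F) × (Fin s → F) × (Fin s → F)) × F × F) := fun z =>
    Submodule.span F {φ 2 (z 2) - φ 0 (z 0) - φ 1 (z 1), φ 3 (z 3) - φ 0 (z 0) - a • φ 1 (z 1)}
  have hE : Emb (((Fin s → F) × (Fin s → F) × (Fin s → F)) × F × F) n Z := by
    refine emb_linear a ha0 ha1 Z φ hφ W (fun z _ => Submodule.subset_span (by simp))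
      (fun z _ => Submodule.subset_span (by simp)) ?_
    intro z hz z' hz' x y hx hy hx' hy'
    by_contra hne
    have hco : ∀ i j, i ≠ j → z i = z' i → z j = z' j → False := fun i j hij h1 h2 =>
      hne (hZ z hz z' hz' i j hij h1 h2)
    simp only [W, Submodule.mem_span_pair] at hx hy hx' hy'
    obtain ⟨l, m, hx⟩ := hx
    obtain ⟨l₁, m₁, hx'⟩ := hx'
    obtain ⟨l', m', hy⟩ := hy
    obtain ⟨l₁', m₁', hy'⟩ := hy'
    obtain ⟨⟨x1, x2, x3⟩, x4, x5⟩ := x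
    obtain ⟨⟨y1, y2, y3⟩, y4, y5⟩ := y
    simp [φ] at hx hy hx' hy'
    obtain ⟨⟨u1, u2, u3⟩, u4, u5⟩ := hx
    obtain ⟨⟨v1, v2, v3⟩, v4, v5⟩ := hx'
    obtain ⟨⟨s1, s2, s3⟩, s4, s5⟩ := hy
    obtain ⟨⟨t1, t2, t3⟩, t4, t5⟩ := hy'
    have ha1' : a - 1 ≠ 0 := sub_ne_zero.2 ha1
    have hm : m₁ = m := by
      have h : (a - 1) * (m₁ - m) = 0 := by linear_combination u5 - v5 - u4 + v4
      exact sub_eq_zero.1 ((mul_eq_zero.1 h).resolve_left ha1')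
    have hm' : m₁' = m' := by
      have h : (a - 1) * (m₁' - m') = 0 := by linear_combination s5 - t5 - s4 + t4
      exact sub_eq_zero.1 ((mul_eq_zero.1 h).resolve_left ha1')
    subst hm hm'
    have hl : l₁ = l := by linear_combination u4 - v4
    have hl' : l₁' = l' := by linear_combination s4 - t4
    subst hl hl'
    refine core_alg a (ι (z 0) - ι (z' 0)) (ι (z 1) - ι (z' 1)) (ι (z 2) - ι (z' 2))
      (ι (z 3) - ι (z' 3)) l₁ m₁ l₁' m₁'
      (fun h h' => hco 0 1 (by decide) (hι _ _ h) (hι _ _ h'))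
      (fun h h' => hco 0 2 (by decide) (hι _ _ h) (hι _ _ h'))
      (fun h h' => hco 0 3 (by decide) (hι _ _ h) (hι _ _ h'))
      (fun h h' => hco 1 2 (by decide) (hι _ _ h) (hι _ _ h'))
      (fun h h' => hco 1 3 (by decide) (hι _ _ h) (hι _ _ h'))
      (fun h h' => hco 2 3 (by decide) (hι _ _ h) (hι _ _ h')) ?_ ?_ ?_ ?_ ?_ ?_
    · linear_combination (norm := module) u1 - v1
    · linear_combination (norm := module) u2 - v2
    · linear_combination (norm := module) u3 - v3
    · linear_combination (norm := module) s1 - t1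
    · linear_combination (norm := module) s2 - t2
    · linear_combination (norm := module) s3 - t3
  refine emb_zero_iff ?_ hE
  simp
  ring

theorem emb_primePow {p e : ℕ} (hp : p.Prime) (he : e ≠ 0) (h3 : 3 ≤ p ^ e) (s : ℕ) {n : ℕ}
    (hn : n ≤ (p ^ e) ^ s) (Z : Set (Fin 4 → Fin n)) (hZ : Dist3 Z) :
    Emb (Fin ((p ^ e) ^ (3 * s + 2))) n Z := by
  have := Fact.mk hp
  have : Fintype (GaloisField p e) := Fintype.ofFinite _
  have hc : Fintype.card (GaloisField p e) = p ^ e := by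
    rw [← Nat.card_eq_fintype_card, GaloisField.card p e he]
  have := emb_field (GaloisField p e) (by rw [hc]; exact h3) s (by rw [hc]; exact hn) Z hZ
  rwa [hc] at this

theorem three_bin (f g h : Fin 4 → Fin 2)
    (h1 : ∀ a b, a ≠ b → f a = g a → f b = g b → False)
    (h2 : ∀ a b, a ≠ b → f a = h a → f b = h b → False)
    (h3 : ∀ a b, a ≠ b → g a = h a → g b = h b → False) : False := by
  have key : ∀ x y z : Fin 2, ∃ i : Fin 3, (i = 0 → x = y) ∧ (i = 1 → x = z) ∧ (i = 2 → y = z) := by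
    decide
  choose c hc using fun i => key (f i) (g i) (h i)
  obtain ⟨a, b, hab, he⟩ := Fintype.exists_ne_map_eq_of_card_lt c (by simp)
  have hA := hc a
  have hB := hc b
  rw [he] at hA
  generalize c b = j at hA hB
  fin_cases j
  · exact h1 a b hab (hA.1 rfl) (hB.1 rfl)
  · exact h2 a b hab (hA.2.1 rfl) (hB.2.1 rfl)
  · exact h3 a b hab (hA.2.2 rfl) (hB.2.2 rfl)

theorem bin_pair (Z : Set (Fin 4 → Fin 2)) (hZ : Dist3 Z) : ∃ z₀ z₁ : Fin 4 → Fin 2,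
    Z ⊆ {z₀, z₁} ∧ ∀ a b, a ≠ b → z₀ a = z₁ a → z₀ b = z₁ b → False := by
  by_cases hs : Z.Subsingleton
  · have hne : ∀ x : Fin 2, x ≠ x + 1 := by decide
    rcases Z.eq_empty_or_nonempty with h | ⟨z, hz⟩
    · exact ⟨0, fun _ => 0 + 1, by simp [h], fun a b _ h' => absurd h' (hne 0)⟩
    · exact ⟨z, fun k => z k + 1, fun y hy => Or.inl (hs hy hz), fun a b _ h' => absurd h' (hne _)⟩
  · rw [Set.not_subsingleton_iff] at hs
    obtain ⟨z₀, h0, z₁, h1, hne⟩ := hs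
    have hd : ∀ z ∈ Z, ∀ z' ∈ Z, z ≠ z' → ∀ a b, a ≠ b → z a = z' a → z b = z' b → False :=
      fun z hz z' hz' hn a b hab e1 e2 => hn (hZ z hz z' hz' a b hab e1 e2)
    refine ⟨z₀, z₁, ?_, hd _ h0 _ h1 hne⟩
    intro y hy
    by_contra hc
    simp only [Set.mem_insert_iff, Set.mem_singleton_iff, not_or] at hc
    exact three_bin z₀ z₁ y (hd _ h0 _ h1 hne) (hd _ h0 _ hy (Ne.symm hc.1))
      (hd _ h1 _ hy (Ne.symm hc.2))

/-- Two quadruples embed into any large enough array. -/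
theorem emb_two {N : ℕ} (hN : 5 ≤ N) (hOA : ∃ A : Fin N × Fin N → Fin 4 → Fin N, IsOA A)
    (Z : Set (Fin 4 → Fin 2)) (hZ : Dist3 Z) : Emb (Fin N) 2 Z := by
  classical
  obtain ⟨A, hA⟩ := hOA
  obtain ⟨z₀, z₁, hsub, hdist⟩ := bin_pair Z hZ
  have : NeZero N := ⟨by omega⟩
  have : Nontrivial (Fin N) := Fin.nontrivial_iff_two_le.2 (by omega)
  let p₀ : Fin N × Fin N := (0, 0)
  have hp₁ : ∃ p₁, ∀ k, A p₁ k = A p₀ k ↔ z₁ k = z₀ k := by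
    by_cases h : ∃ i, z₁ i = z₀ i
    · obtain ⟨i, hi⟩ := h
      obtain ⟨j, hj⟩ : ∃ j, j ≠ i := exists_ne i
      have hsurj := Finite.surjective_of_injective (hA i j hj.symm)
      obtain ⟨y, hy⟩ := exists_ne (A p₀ j)
      obtain ⟨p, hp⟩ := hsurj (A p₀ i, y)
      simp only [Prod.mk.injEq] at hp
      refine ⟨p, fun k => ?_⟩
      by_cases hk : k = i
      · subst hk
        simp [hp.1, hi]
      · constructor
        · intro h
          have : p = p₀ := hA i k (Ne.symm hk) (Prod.ext hp.1 h)
          rw [this] at hp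
          exact absurd hp.2.symm hy
        · intro h
          exact (hdist k i hk h.symm hi.symm).elim
    · push Not at h
      let S : Fin 4 → Finset (Fin N × Fin N) := fun k => Finset.univ.filter fun p => A p k = A p₀ k
      have hS : ∀ k, (S k).card ≤ N := by
        intro k
        obtain ⟨j, hj⟩ : ∃ j, j ≠ k := exists_ne k
        have := Finset.card_le_card_of_injOn (s := S k) (t := Finset.univ) (fun p => A p j)
          (by simp) (by
            intro p hp q hq hpq
            simp only [S, Finset.coe_filter, Finset.mem_univ, true_and, Set.mem_ofPred_eq] at hp hq
            exact hA k j hj.symm (Prod.ext (hp.trans hq.symm) hpq))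
        simpa using this
      have hU : (Finset.univ.biUnion S).card ≤ 4 * N := by
        refine Finset.card_biUnion_le.trans ?_
        refine (Finset.sum_le_sum fun k _ => hS k).trans ?_
        simp
      have : ∃ p, p ∉ Finset.univ.biUnion S := by
        by_contra hall
        push Not at hall
        have he : Finset.univ.biUnion S = Finset.univ := Finset.eq_univ_of_forall hall
        rw [he, Finset.card_univ, Fintype.card_prod, Fintype.card_fin] at hU
        nlinarith
      obtain ⟨p, hp⟩ := this
      simp only [S, Finset.mem_biUnion, Finset.mem_univ, Finset.mem_filter, true_and,
        not_exists] at hp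
      exact ⟨p, fun k => ⟨fun e => absurd e (hp k), fun e => absurd e (h k)⟩⟩
  obtain ⟨p₁, hp₁⟩ := hp₁
  choose o ho using fun k => exists_ne (A p₀ k)
  let w : Fin 4 → Fin N := fun k => if A p₁ k = A p₀ k then o k else A p₁ k
  have hw : ∀ k, w k ≠ A p₀ k := by
    intro k
    by_cases h : A p₁ k = A p₀ k
    · simp only [w, if_pos h]; exact ho k
    · simp only [w, if_neg h]; exact h
  refine ⟨A, hA, fun k x => if x = z₀ k then A p₀ k else w k, ?_, ?_⟩
  · intro k x y hxy
    have h2 : ∀ x y z : Fin 2, x ≠ z → y ≠ z → x = y := by decide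
    by_cases hx : x = z₀ k <;> by_cases hy : y = z₀ k
    · exact hx.trans hy.symm
    · simp only [if_pos hx, if_neg hy] at hxy
      exact absurd hxy.symm (hw k)
    · simp only [if_neg hx, if_pos hy] at hxy
      exact absurd hxy (hw k)
    · exact h2 _ _ _ hx hy
  · intro z hz
    rcases hsub hz with h | h
    · subst h
      exact ⟨p₀, fun k => by simp⟩
    · have h : z = z₁ := h
      subst h
      refine ⟨p₁, fun k => ?_⟩
      by_cases hk : z k = z₀ k
      · simp only [if_pos hk]; exact (hp₁ k).2 hk
      · have : ¬ A p₁ k = A p₀ k := fun h => hk ((hp₁ k).1 h)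
        simp only [if_neg hk, w, if_neg this]


theorem fill_both {M t n : ℕ} {Z : Set (Fin 4 → Fin n)} (hT : HasOA 9 M) (h4 : M % 4 = 0)
    (hM : Emb (Fin M) n Z) (ht : 1600 ≤ t) (h7 : 7 * M ≤ t) : Emb (Fin t) n Z := by
  by_cases h9 : 9 * M ≤ t
  · exact fill_large hM ht h9
  · exact fill_range hT hM h7 (Or.inr ⟨h4, by omega⟩)

theorem emb_general {n t : ℕ} (hn : 46 ≤ n) (ht : 48 * n ^ 4 ≤ t) (Z : Set (Fin 4 → Fin n))
    (hZ : Dist3 Z) : Emb (Fin t) n Z := by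
  have hex : ∃ s, n ≤ 3 ^ s := ⟨n, (Nat.lt_pow_self (by norm_num)).le⟩
  classical
  obtain ⟨s, hs, hmin⟩ : ∃ s, n ≤ 3 ^ s ∧ ∀ s' < s, ¬ n ≤ 3 ^ s' :=
    ⟨Nat.find hex, Nat.find_spec hex, fun s' h => Nat.find_min hex h⟩
  obtain ⟨u, rfl⟩ : ∃ u, s = u + 1 := by
    rcases s with _ | u
    · simp at hs; omega
    · exact ⟨u, rfl⟩
  have hu : 3 ^ u < n := not_le.1 (hmin u (by omega))
  have hE := emb_primePow (p := 3) (e := 1) Nat.prime_three one_ne_zero (by norm_num) (u + 1)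
    (by simpa using hs) Z hZ
  have h3 : (3 ^ u) ^ 3 ≤ n ^ 3 := Nat.pow_le_pow_left hu.le 3
  have hM : (3 ^ 1) ^ (3 * (u + 1) + 2) = 243 * (3 ^ u) ^ 3 := by
    rw [pow_one, ← pow_mul, mul_comm u 3, show 3 * (u + 1) + 2 = 3 * u + 5 by ring, pow_add]
    norm_num [mul_comm]
  have h4 : 46 * n ^ 3 ≤ n ^ 4 := by
    rw [pow_succ n 3, mul_comm]
    exact Nat.mul_le_mul_left _ hn
  have h5 : 46 ^ 3 ≤ n ^ 3 := Nat.pow_le_pow_left hn 3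
  rw [hM] at hE
  generalize (3 ^ u) ^ 3 = q at *
  exact fill_large hE (by omega) (by omega)

theorem emb_main {n t : ℕ} (hn : 1 ≤ n) (ht : 48 * n ^ 4 ≤ t) (Z : Set (Fin 4 → Fin n))
    (hZ : Dist3 Z) : Emb (Fin t) n Z := by
  have hmono : ∀ k, k ≤ n → k ^ 4 ≤ n ^ 4 := fun k hk => Nat.pow_le_pow_left hk 4
  by_cases c1 : n = 1
  · have := hmono 1 (by omega)
    exact emb_of_oa_one (by omega) (by omega) (oa_all (by omega))
  by_cases c2 : n = 2
  · have := hmono 2 (by omega)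
    subst c2
    exact emb_two (by omega) (oa_all (by omega)) Z hZ
  by_cases c3 : n ≤ 3
  · have h := hmono 3 (by omega)
    have hE := emb_primePow (p := 3) (e := 1) Nat.prime_three one_ne_zero (by norm_num) 1
      (by norm_num; omega) Z hZ
    norm_num at hE h
    exact fill_large hE (by omega) (by omega)
  by_cases c4 : n ≤ 4
  · have h := hmono 4 (by omega)
    have hE := emb_primePow (p := 2) (e := 2) Nat.prime_two two_ne_zero (by norm_num) 1
      (by norm_num; omega) Z hZ
    norm_num at hE h
    exact fill_large hE (by omega) (by omega)
  by_cases c5 : n ≤ 5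
  · have h := hmono 5 (by omega)
    have hE := emb_primePow (p := 5) (e := 1) Nat.prime_five one_ne_zero (by norm_num) 1
      (by norm_num; omega) Z hZ
    norm_num at hE h
    exact fill_large hE (by omega) (by omega)
  by_cases c6 : n ≤ 9
  · have h := hmono 6 (by omega)
    have hE := emb_primePow (p := 3) (e := 1) Nat.prime_three one_ne_zero (by norm_num) 2
      (by norm_num; omega) Z hZ
    norm_num at hE h
    exact fill_large hE (by omega) (by omega)
  by_cases c7 : n ≤ 16
  · have h := hmono 10 (by omega)
    have hE := emb_primePow (p := 2) (e := 2) Nat.prime_two two_ne_zero (by norm_num) 2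
      (by norm_num; omega) Z hZ
    have hO := HasOA.primePow (k := 9) (p := 2) (e := 16) Nat.prime_two (by norm_num) (by norm_num)
    norm_num at hE h hO
    exact fill_both hO (by norm_num) hE (by omega) (by omega)
  by_cases c8 : n ≤ 27
  · have h := hmono 17 (by omega)
    have hE := emb_primePow (p := 3) (e := 1) Nat.prime_three one_ne_zero (by norm_num) 3
      (by norm_num; omega) Z hZ
    norm_num at hE h
    exact fill_large hE (by omega) (by omega)
  by_cases c9 : n ≤ 64
  · have h := hmono 28 (by omega)
    have hE := emb_primePow (p := 2) (e := 2) Nat.prime_two two_ne_zero (by norm_num) 3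
      (by norm_num; omega) Z hZ
    have hO := HasOA.primePow (k := 9) (p := 2) (e := 22) Nat.prime_two (by norm_num) (by norm_num)
    norm_num at hE h hO
    exact fill_both hO (by norm_num) hE (by omega) (by omega)
  exact emb_general (by omega) ht Z hZ


theorem embeds_of_emb {n t : ℕ} {P Q : Set (ℕ × ℕ × ℕ)} (hP : IsPLS n P) (hQ : IsPLS n Q)
    (hPQ : OrthPLS P Q)
    (h : Emb (Fin t) n {z | ((z 0 : ℕ), (z 1 : ℕ), (z 2 : ℕ)) ∈ P ∧
      ((z 0 : ℕ), (z 1 : ℕ), (z 3 : ℕ)) ∈ Q}) : EmbedsInOrthogonalPair n t P Q := by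
  classical
  obtain ⟨A, hA, φ, hφ, hz⟩ := h
  have hsurj := Finite.surjective_of_injective (hA 0 1 (by decide))
  choose B hB using hsurj
  have hB0 : ∀ q, A (B q) 0 = q.1 := fun q => congrArg Prod.fst (hB q)
  have hB1 : ∀ q, A (B q) 1 = q.2 := fun q => congrArg Prod.snd (hB q)
  have hBA : ∀ p, B (A p 0, A p 1) = p := fun p => hA 0 1 (by decide) (hB _)
  let L : Fin 4 → ℕ → ℕ → ℕ := fun k r c =>
    if h : r < t ∧ c < t then (A (B (⟨r, h.1⟩, ⟨c, h.2⟩)) k : ℕ) else 0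
  have hL : ∀ k (r c : Fin t), L k r c = A (B (r, c)) k := by
    intro k r c
    simp only [L, dif_pos (And.intro r.2 c.2)]
  let g : Fin 4 → ℕ → ℕ := fun k x => if h : x < n then (φ k ⟨x, h⟩ : ℕ) else 0
  have hg : ∀ k (x : Fin n), g k x = φ k x := by
    intro k x
    simp only [g, dif_pos x.2]
  have hglt : ∀ k x, x < n → g k x < t := by
    intro k x hx
    rw [hg k ⟨x, hx⟩]
    exact Fin.isLt _
  have hginj : ∀ k x y, x < n → y < n → g k x = g k y → x = y := by
    intro k x y hx hy e
    rw [hg k ⟨x, hx⟩, hg k ⟨y, hy⟩] at e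
    exact congrArg Fin.val (hφ k (Fin.ext e))
  have hlat : ∀ k, k ≠ 0 → k ≠ 1 → IsLatin t (L k) := by
    intro k h0 h1
    refine ⟨?_, ?_, ?_⟩
    · intro r c hr hc
      rw [hL k ⟨r, hr⟩ ⟨c, hc⟩]
      exact Fin.isLt _
    · intro r c₁ c₂ hr hc₁ hc₂ e
      rw [hL k ⟨r, hr⟩ ⟨c₁, hc₁⟩, hL k ⟨r, hr⟩ ⟨c₂, hc₂⟩] at e
      have := @hA 0 k h0.symm (B (⟨r, hr⟩, ⟨c₁, hc₁⟩)) (B (⟨r, hr⟩, ⟨c₂, hc₂⟩))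
        (Prod.ext ((hB0 _).trans (hB0 (⟨r, hr⟩, ⟨c₂, hc₂⟩)).symm) (Fin.ext e))
      have h2 := congrArg (fun p => A p 1) this
      simp only [hB1] at h2
      exact congrArg Fin.val h2
    · intro r₁ r₂ c hr₁ hr₂ hc e
      rw [hL k ⟨r₁, hr₁⟩ ⟨c, hc⟩, hL k ⟨r₂, hr₂⟩ ⟨c, hc⟩] at e
      have := @hA 1 k h1.symm (B (⟨r₁, hr₁⟩, ⟨c, hc⟩)) (B (⟨r₂, hr₂⟩, ⟨c, hc⟩))
        (Prod.ext ((hB1 _).trans (hB1 (⟨r₂, hr₂⟩, ⟨c, hc⟩)).symm) (Fin.ext e))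
      have h2 := congrArg (fun p => A p 0) this
      simp only [hB0] at h2
      exact congrArg Fin.val h2
  have hmain : ∀ z : Fin 4 → Fin n, ((z 0 : ℕ), (z 1 : ℕ), (z 2 : ℕ)) ∈ P →
      ((z 0 : ℕ), (z 1 : ℕ), (z 3 : ℕ)) ∈ Q → ∀ k, L k (g 0 (z 0)) (g 1 (z 1)) = g k (z k) := by
    intro z h1 h2 k
    obtain ⟨p, hp⟩ := hz z ⟨h1, h2⟩
    rw [hg, hg, hg, hL, ← hp 0, ← hp 1, hBA, hp k]
  have hboth : ∀ r c e e', (r, c, e) ∈ P → (r, c, e') ∈ Q →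
      L 2 (g 0 r) (g 1 c) = g 2 e ∧ L 3 (g 0 r) (g 1 c) = g 3 e' := by
    intro r c e e' h1 h2
    obtain ⟨hr, hc, he⟩ := hP.1 _ h1
    obtain ⟨_, _, he'⟩ := hQ.1 _ h2
    have := hmain ![⟨r, hr⟩, ⟨c, hc⟩, ⟨e, he⟩, ⟨e', he'⟩] h1 h2
    exact ⟨this 2, this 3⟩
  refine ⟨L 2, L 3, g 0, g 1, g 2, g 3, hlat 2 (by decide) (by decide),
    hlat 3 (by decide) (by decide), ?_, hglt 0, hglt 1, hglt 2, hglt 3,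
    hginj 0, hginj 1, hginj 2, hginj 3, ?_, ?_⟩
  · intro r₁ c₁ r₂ c₂ hr₁ hc₁ hr₂ hc₂ hne e1 e2
    rw [hL 2 ⟨r₁, hr₁⟩ ⟨c₁, hc₁⟩, hL 2 ⟨r₂, hr₂⟩ ⟨c₂, hc₂⟩] at e1
    rw [hL 3 ⟨r₁, hr₁⟩ ⟨c₁, hc₁⟩, hL 3 ⟨r₂, hr₂⟩ ⟨c₂, hc₂⟩] at e2
    have := hA 2 3 (by decide) (Prod.ext (Fin.ext e1) (Fin.ext e2))
    have h1 := congrArg (fun p => A p 0) this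
    have h2 := congrArg (fun p => A p 1) this
    simp only [hB0, hB1] at h1 h2
    exact hne (Prod.ext (congrArg Fin.val h1) (congrArg Fin.val h2))
  · intro r c e h1
    obtain ⟨e', h2⟩ := (hPQ.1 r c).1 ⟨e, h1⟩
    exact (hboth r c e e' h1 h2).1
  · intro r c e' h2
    obtain ⟨e, h1⟩ := (hPQ.1 r c).2 ⟨e', h2⟩
    exact (hboth r c e e' h1 h2).2

theorem dist3_of_pls {n : ℕ} {P Q : Set (ℕ × ℕ × ℕ)} (hP : IsPLS n P) (hQ : IsPLS n Q)
    (hPQ : OrthPLS P Q) :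
    Dist3 {z : Fin 4 → Fin n | ((z 0 : ℕ), (z 1 : ℕ), (z 2 : ℕ)) ∈ P ∧
      ((z 0 : ℕ), (z 1 : ℕ), (z 3 : ℕ)) ∈ Q} := by
  rintro z ⟨h1, h2⟩ z' ⟨h1', h2'⟩
  obtain ⟨-, P1, P2, P3⟩ := hP
  obtain ⟨-, Q1, Q2, Q3⟩ := hQ
  have hcell : z 0 = z' 0 → z 1 = z' 1 → z = z' := by
    intro e0 e1
    rw [← e0, ← e1] at h1' h2'
    have e2 := Fin.ext (P1 _ _ _ _ h1 h1')
    have e3 := Fin.ext (Q1 _ _ _ _ h2 h2')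
    funext k
    fin_cases k
    exacts [e0, e1, e2, e3]
  have h02 : z 0 = z' 0 → z 2 = z' 2 → z = z' := fun e0 e2 =>
    hcell e0 (by rw [← e0, ← e2] at h1'; exact Fin.ext (P2 _ _ _ _ h1 h1'))
  have h03 : z 0 = z' 0 → z 3 = z' 3 → z = z' := fun e0 e3 =>
    hcell e0 (by rw [← e0, ← e3] at h2'; exact Fin.ext (Q2 _ _ _ _ h2 h2'))
  have h12 : z 1 = z' 1 → z 2 = z' 2 → z = z' := fun e1 e2 =>
    hcell (by rw [← e1, ← e2] at h1'; exact Fin.ext (P3 _ _ _ _ h1 h1')) e1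
  have h13 : z 1 = z' 1 → z 3 = z' 3 → z = z' := fun e1 e3 =>
    hcell (by rw [← e1, ← e3] at h2'; exact Fin.ext (Q3 _ _ _ _ h2 h2')) e1
  have h23 : z 2 = z' 2 → z 3 = z' 3 → z = z' := by
    intro e2 e3
    by_cases hc : (((z 0 : ℕ), (z 1 : ℕ)) : ℕ × ℕ) = ((z' 0 : ℕ), (z' 1 : ℕ))
    · exact hcell (Fin.ext (congrArg Prod.fst hc)) (Fin.ext (congrArg Prod.snd hc))
    · rw [← e2] at h1'
      exact absurd (congrArg Fin.val e3) (hPQ.2 _ _ _ _ _ _ _ hc h1 h1' h2 h2')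
  intro a b hab ea eb
  fin_cases a <;> fin_cases b
  · exact absurd rfl hab
  · exact hcell ea eb
  · exact h02 ea eb
  · exact h03 ea eb
  · exact hcell eb ea
  · exact absurd rfl hab
  · exact h12 ea eb
  · exact h13 ea eb
  · exact h02 eb ea
  · exact h12 eb ea
  · exact absurd rfl hab
  · exact h23 ea eb
  · exact h03 eb ea
  · exact h13 eb ea
  · exact h23 eb ea
  · exact absurd rfl hab


/-- A pair of orthogonal partial latin squares of order `n` embeds in a pair of
orthogonal latin squares of every order `t ≥ 48 n⁴`. -/
theorem embedding_all_orders_from_fortyeight_n_fourth (n : ℕ) (hn : 1 ≤ n)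
    (P Q : Set (ℕ × ℕ × ℕ))
    (hP : IsPLS n P) (hQ : IsPLS n Q) (hPQ : OrthPLS P Q) :
    ∀ t : ℕ, 48 * n ^ 4 ≤ t → EmbedsInOrthogonalPair n t P Q := by
  intro t ht
  exact embeds_of_emb hP hQ hPQ (emb_main hn ht _ (dist3_of_pls hP hQ hPQ))
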